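/- Fix a natural number K ≥ 2 and a cost function c : ℕ × ℕ → ℝ. Let r_1, …, r_m be pairwise disjoint finite subsets of ℕ, let R = r_1 ∪ … ∪ r_m, and suppose that every K-adic interval contained in R is contained in some r_i. Then minCost(R) = ∑_{i=1}^m minCost(r_i). Moreover, if for each i the set P_i is a minimum-cost hierarchical partition of r_i, then P_1 ∪ … ∪ P_m is a minimum-cost hierarchical partition of R. -/

import Mathlib

/-- The `K`-adic interval of level `l` and index `a`:
`I(l,a) = {x : ℕ | a·K^l ≤ x < (a+1)·K^l}`. -/
def kInt (K l a : ℕ) : Finset ℕ := Finset.Ico (a * K ^ l) ((a + 1) * K ^ l)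

/-- `P` is a hierarchical partition of the finite set `R`: the K-adic intervals
indexed by the pairs in `P` are pairwise disjoint and their union is `R`. -/
def IsHierPart (K : ℕ) (P : Finset (ℕ × ℕ)) (R : Finset ℕ) : Prop :=
  (∀ p ∈ P, ∀ q ∈ P, p ≠ q → Disjoint (kInt K p.1 p.2) (kInt K q.1 q.2)) ∧
  P.biUnion (fun p => kInt K p.1 p.2) = R

/-- The cost of a hierarchical partition. -/
def cost (c : ℕ × ℕ → ℝ) (P : Finset (ℕ × ℕ)) : ℝ := ∑ p ∈ P, c p

/-- The minimum cost over all hierarchical partitions of `R` (as an infimum of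
the set of attainable costs; for finite `R` this set is finite and nonempty,
so the infimum is a minimum). -/
noncomputable def minCost (K : ℕ) (c : ℕ × ℕ → ℝ) (R : Finset ℕ) : ℝ :=
  sInf {x : ℝ | ∃ P : Finset (ℕ × ℕ), IsHierPart K P R ∧ cost c P = x}

theorem left_mem_kInt {K : ℕ} (hK : 2 ≤ K) (l a : ℕ) : a * K ^ l ∈ kInt K l a := by
  have : 0 < K ^ l := by positivity
  simp only [kInt, Finset.mem_Ico]
  constructor <;> nlinarith

theorem isHierPart_singletons (K : ℕ) (R : Finset ℕ) :
    IsHierPart K (R.image fun x => (0, x)) R := by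
  refine ⟨?_, ?_⟩
  · intro p hp q hq hpq
    obtain ⟨x, -, rfl⟩ := Finset.mem_image.1 hp
    obtain ⟨y, -, rfl⟩ := Finset.mem_image.1 hq
    have hxy : x ≠ y := fun h => hpq (by rw [h])
    simpa [kInt] using hxy
  · ext x
    simp only [kInt, Finset.mem_biUnion, Finset.mem_image, Finset.mem_Ico, exists_exists_and_eq_and,
      pow_zero, mul_one, Nat.lt_succ_iff]
    exact ⟨fun ⟨y, hy, h₁, h₂⟩ => le_antisymm h₁ h₂ ▸ hy, fun hx => ⟨x, hx, le_rfl, le_rfl⟩⟩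

theorem IsHierPart.subset {K : ℕ} {P : Finset (ℕ × ℕ)} {R : Finset ℕ} (h : IsHierPart K P R)
    {p : ℕ × ℕ} (hp : p ∈ P) : kInt K p.1 p.2 ⊆ R :=
  h.2 ▸ Finset.subset_biUnion_of_mem (fun p : ℕ × ℕ => kInt K p.1 p.2) hp

theorem finite_setOf_isHierPart {K : ℕ} (hK : 2 ≤ K) (R : Finset ℕ) :
    {P : Finset (ℕ × ℕ) | IsHierPart K P R}.Finite := by
  set N := R.sup id + 1
  refine ((Finset.range N ×ˢ Finset.range N).powerset.finite_toSet).subset fun P hP => ?_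
  simp only [Finset.mem_coe, Finset.mem_powerset]
  intro p hp
  have hlt : p.1 < K ^ p.1 := Nat.lt_pow_self hK
  have hsup : ∀ x ∈ kInt K p.1 p.2, x ≤ R.sup id := fun x hx =>
    Finset.le_sup (f := id) (hP.subset hp hx)
  have hleft := hsup _ (left_mem_kInt hK p.1 p.2)
  have hright : p.2 * K ^ p.1 + p.1 ≤ R.sup id :=
    hsup _ (by simp only [kInt, Finset.mem_Ico]; constructor <;> nlinarith)
  have : p.2 ≤ p.2 * K ^ p.1 := Nat.le_mul_of_pos_right _ (by omega)
  simp only [Finset.mem_product, Finset.mem_range]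
  omega

theorem finite_costs {K : ℕ} (hK : 2 ≤ K) (c : ℕ × ℕ → ℝ) (R : Finset ℕ) :
    {x : ℝ | ∃ P : Finset (ℕ × ℕ), IsHierPart K P R ∧ cost c P = x}.Finite :=
  (finite_setOf_isHierPart hK R).image (cost c)

theorem minCost_le {K : ℕ} (hK : 2 ≤ K) (c : ℕ × ℕ → ℝ) {P : Finset (ℕ × ℕ)} {R : Finset ℕ}
    (h : IsHierPart K P R) : minCost K c R ≤ cost c P :=
  csInf_le (finite_costs hK c R).bddBelow ⟨P, h, rfl⟩

theorem exists_cost_eq_minCost {K : ℕ} (hK : 2 ≤ K) (c : ℕ × ℕ → ℝ) (R : Finset ℕ) :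
    ∃ P, IsHierPart K P R ∧ cost c P = minCost K c R :=
  (show Set.Nonempty {x : ℝ | ∃ P : Finset (ℕ × ℕ), IsHierPart K P R ∧ cost c P = x} from
    ⟨_, _, isHierPart_singletons K R, rfl⟩).csInf_mem (finite_costs hK c R)

section Decomposition

variable {ι : Type*} {K : ℕ} {r : ι → Finset ℕ}

theorem eq_of_kInt_subset (hK : 2 ≤ K) (hdisj : ∀ i j, i ≠ j → Disjoint (r i) (r j))
    {p : ℕ × ℕ} {i j : ι} (hi : kInt K p.1 p.2 ⊆ r i) (hj : kInt K p.1 p.2 ⊆ r j) : i = j := by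
  by_contra hij
  exact Finset.disjoint_left.1 (hdisj i j hij) (hi (left_mem_kInt hK _ _))
    (hj (left_mem_kInt hK _ _))

variable [Fintype ι]

theorem isHierPart_biUnion (hdisj : ∀ i j, i ≠ j → Disjoint (r i) (r j))
    {P : ι → Finset (ℕ × ℕ)} (hP : ∀ i, IsHierPart K (P i) (r i)) :
    IsHierPart K (Finset.univ.biUnion P) (Finset.univ.biUnion r) := by
  refine ⟨fun p hp q hq hpq => ?_, ?_⟩
  · obtain ⟨i, -, hi⟩ := Finset.mem_biUnion.1 hp
    obtain ⟨j, -, hj⟩ := Finset.mem_biUnion.1 hq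
    by_cases hij : i = j
    · subst hij
      exact (hP i).1 p hi q hj hpq
    · exact (hdisj i j hij).mono ((hP i).subset hi) ((hP j).subset hj)
  · rw [Finset.biUnion_biUnion]
    exact Finset.biUnion_congr rfl fun i _ => (hP i).2

theorem cost_biUnion (hK : 2 ≤ K) (c : ℕ × ℕ → ℝ)
    (hdisj : ∀ i j, i ≠ j → Disjoint (r i) (r j))
    {P : ι → Finset (ℕ × ℕ)} (hP : ∀ i, IsHierPart K (P i) (r i)) :
    cost c (Finset.univ.biUnion P) = ∑ i, cost c (P i) :=
  Finset.sum_biUnion fun i _ j _ hij => Finset.disjoint_left.2 fun _ hi hj =>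
    hij (eq_of_kInt_subset hK hdisj ((hP i).subset hi) ((hP j).subset hj))

theorem IsHierPart.exists_eq_biUnion
    (hdisj : ∀ i j, i ≠ j → Disjoint (r i) (r j))
    (hsplit : ∀ l a, kInt K l a ⊆ Finset.univ.biUnion r → ∃ i, kInt K l a ⊆ r i)
    {Q : Finset (ℕ × ℕ)} (hQ : IsHierPart K Q (Finset.univ.biUnion r)) :
    ∃ P : ι → Finset (ℕ × ℕ), (∀ i, IsHierPart K (P i) (r i)) ∧ Finset.univ.biUnion P = Q := by
  refine ⟨fun i => {p ∈ Q | kInt K p.1 p.2 ⊆ r i}, fun i => ⟨?_, ?_⟩, ?_⟩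
  · exact fun p hp q hq => hQ.1 p (Finset.mem_filter.1 hp).1 q (Finset.mem_filter.1 hq).1
  · ext x
    simp only [Finset.mem_biUnion, Finset.mem_filter]
    refine ⟨fun ⟨p, hp, hx⟩ => hp.2 hx, fun hx => ?_⟩
    have hxR : x ∈ Finset.univ.biUnion r := Finset.mem_biUnion.2 ⟨i, Finset.mem_univ i, hx⟩
    rw [← hQ.2] at hxR
    obtain ⟨p, hp, hxp⟩ := Finset.mem_biUnion.1 hxR
    obtain ⟨j, hj⟩ := hsplit p.1 p.2 (hQ.subset hp)
    obtain rfl : i = j := by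
      by_contra hij
      exact Finset.disjoint_left.1 (hdisj i j hij) hx (hj hxp)
    exact ⟨p, ⟨hp, hj⟩, hxp⟩
  · ext p
    simp only [Finset.mem_biUnion, Finset.mem_filter, Finset.mem_univ, true_and]
    refine ⟨fun ⟨_, hp, _⟩ => hp, fun hp => ?_⟩
    obtain ⟨i, hi⟩ := hsplit p.1 p.2 (hQ.subset hp)
    exact ⟨i, hp, hi⟩

theorem minCost_biUnion (hK : 2 ≤ K) (c : ℕ × ℕ → ℝ)
    (hdisj : ∀ i j, i ≠ j → Disjoint (r i) (r j))
    (hsplit : ∀ l a, kInt K l a ⊆ Finset.univ.biUnion r → ∃ i, kInt K l a ⊆ r i) :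
    minCost K c (Finset.univ.biUnion r) = ∑ i, minCost K c (r i) := by
  apply le_antisymm
  · choose P hP hcost using fun i => exists_cost_eq_minCost hK c (r i)
    calc minCost K c (Finset.univ.biUnion r)
        ≤ cost c (Finset.univ.biUnion P) := minCost_le hK c (isHierPart_biUnion hdisj hP)
      _ = ∑ i, minCost K c (r i) := by simp only [cost_biUnion hK c hdisj hP, hcost]
  · obtain ⟨Q, hQ, hcost⟩ := exists_cost_eq_minCost hK c (Finset.univ.biUnion r)
    obtain ⟨P, hP, rfl⟩ := hQ.exists_eq_biUnion hdisj hsplit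
    rw [← hcost, cost_biUnion hK c hdisj hP]
    exact Finset.sum_le_sum fun i _ => minCost_le hK c (hP i)

end Decomposition

/-- Theorem 1 of the paper: if `R` is the union of pairwise disjoint pieces
`r 1, …, r m` and every K-adic interval contained in `R` lies inside a single
piece, then `minCost(R) = ∑ i, minCost(r i)`, and the union of minimum-cost
hierarchical partitions of the pieces is a minimum-cost hierarchical partition
of `R`. -/
theorem minCost_decompose (K : ℕ) (hK : 2 ≤ K) (c : ℕ × ℕ → ℝ)
    (m : ℕ) (r : Fin m → Finset ℕ)
    (hdisj : ∀ i j : Fin m, i ≠ j → Disjoint (r i) (r j))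
    (R : Finset ℕ) (hR : R = Finset.univ.biUnion r)
    (hsplit : ∀ l a : ℕ, kInt K l a ⊆ R → ∃ i : Fin m, kInt K l a ⊆ r i) :
    minCost K c R = ∑ i : Fin m, minCost K c (r i) ∧
    ∀ P : Fin m → Finset (ℕ × ℕ),
      (∀ i : Fin m, IsHierPart K (P i) (r i) ∧ cost c (P i) = minCost K c (r i)) →
      IsHierPart K (Finset.univ.biUnion P) R ∧
        cost c (Finset.univ.biUnion P) = minCost K c R := by
  subst hR
  have hmin := minCost_biUnion hK c hdisj hsplit
  refine ⟨hmin, fun P hP => ⟨isHierPart_biUnion hdisj fun i => (hP i).1, ?_⟩⟩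
  rw [cost_biUnion hK c hdisj fun i => (hP i).1, hmin]
  exact Finset.sum_congr rfl fun i _ => (hP i).2
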